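/- Let x₀ < 0 < y₀ and let T > 0. Suppose (x, y) : [0,T) → ℝ² is differentiable, satisfies x(0) = x₀, y(0) = y₀, remains in the quadrant {x < 0, y > 0} on [0,T), and solves the point-vortex system dx/dt = (1/(4π)) x² / ( y (x² + y²) ), dy/dt = (1/(4π)) x / (x² + y²). Then the ratio x(t)/y(t) is a constant of motion: x(t)/y(t) = x₀/y₀ for all t ∈ [0,T). -/

import Mathlib

open Set Real

/-- For the point-vortex system
`dx/dt = (1/4π) x²/(y(x²+y²))`, `dy/dt = (1/4π) x/(x²+y²)` with initial data
`x₀ < 0 < y₀`, as long as the solution stays in the quadrant `{x < 0, y > 0}`,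
the ratio `x(t)/y(t)` is a constant of motion. -/
theorem point_vortex_ratio_conserved
    (x₀ y₀ : ℝ) (hx₀ : x₀ < 0) (hy₀ : 0 < y₀)
    (T : ℝ) (hT : 0 < T)
    (x y : ℝ → ℝ)
    (hx0 : x 0 = x₀) (hy0 : y 0 = y₀)
    (hquad : ∀ t ∈ Ico (0:ℝ) T, x t < 0 ∧ 0 < y t)
    (hx : ∀ t ∈ Ico (0:ℝ) T,
      HasDerivAt x ((1 / (4 * π)) * (x t) ^ 2 / (y t * ((x t) ^ 2 + (y t) ^ 2))) t)
    (hy : ∀ t ∈ Ico (0:ℝ) T,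
      HasDerivAt y ((1 / (4 * π)) * x t / ((x t) ^ 2 + (y t) ^ 2)) t) :
    ∀ t ∈ Ico (0:ℝ) T, x t / y t = x₀ / y₀ := by
  have hderiv : ∀ s ∈ Ico (0 : ℝ) T, HasDerivAt (fun s => x s / y s) 0 s := by
    intro s hs
    have hys : y s ≠ 0 := (hquad s hs).2.ne'
    have hr : x s ^ 2 + y s ^ 2 ≠ 0 := by positivity
    refine ((hx s hs).fun_div (hy s hs) hys).congr_deriv ?_
    field_simp
    ring
  intro t ht
  have hsub : ∀ s ∈ Icc (0 : ℝ) t, s ∈ Ico (0 : ℝ) T :=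
    fun s hs => ⟨hs.1, hs.2.trans_lt ht.2⟩
  have hconst := constant_of_has_deriv_right_zero
    (fun s hs => (hderiv s (hsub s hs)).continuousAt.continuousWithinAt)
    (fun s hs => (hderiv s (hsub s (Ico_subset_Icc_self hs))).hasDerivWithinAt)
    t (right_mem_Icc.mpr ht.1)
  simpa only [hx0, hy0] using hconst
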